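/- Assume in addition that W, H, B are finite-dimensional over 𝕜 and that γ : W → B is surjective. Then the index of the boundary value problem equals the index of S(P): dim ker(D_P) − dim(H / D(dom(D_P))) = dim ker(S(P)) − dim(range(P) / P(K)). -/

import Mathlib

namespace RelZeta

variable {𝕜 : Type*} [Field 𝕜] {W H B : Type*}
  [AddCommGroup W] [Module 𝕜 W] [AddCommGroup H] [Module 𝕜 H]
  [AddCommGroup B] [Module 𝕜 B]

/-- The Calderon subspace `K = γ(N) = γ(ker D) ⊆ B`. -/
def Calderon (D : W →ₗ[𝕜] H) (γ : W →ₗ[𝕜] B) : Submodule 𝕜 B :=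
  (LinearMap.ker D).map γ

/-- The domain `dom(D_P) = {u ∈ W : P(γ u) = 0}` of the boundary value problem. -/
def bvpDom (γ : W →ₗ[𝕜] B) (P : B →ₗ[𝕜] B) : Submodule 𝕜 W :=
  LinearMap.ker (P.comp γ)

/-- The boundary value problem `D_P : dom(D_P) → H`, the restriction of `D`. -/
def bvp (D : W →ₗ[𝕜] H) (γ : W →ₗ[𝕜] B) (P : B →ₗ[𝕜] B) :
    ↥(bvpDom γ P) →ₗ[𝕜] H :=
  D.comp (bvpDom γ P).subtype

/-- `S(P) : K → range P`, the restriction of `P` to the Calderon subspace. -/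
def SP (D : W →ₗ[𝕜] H) (γ : W →ₗ[𝕜] B) (P : B →ₗ[𝕜] B) :
    ↥(Calderon D γ) →ₗ[𝕜] ↥(LinearMap.range P) :=
  LinearMap.codRestrict (LinearMap.range P) (P.comp (Calderon D γ).subtype)
    (fun c => LinearMap.mem_range_self P _)

/-- The index of a linear map between finite-dimensional spaces depends only on the spaces. -/
theorem finrank_ker_sub_finrank_coker {V U : Type*} [AddCommGroup V] [Module 𝕜 V]
    [AddCommGroup U] [Module 𝕜 U] [FiniteDimensional 𝕜 V] [FiniteDimensional 𝕜 U]
    (f : V →ₗ[𝕜] U) :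
    (Module.finrank 𝕜 ↥(LinearMap.ker f) : ℤ) - Module.finrank 𝕜 (U ⧸ LinearMap.range f) =
      Module.finrank 𝕜 V - Module.finrank 𝕜 U := by
  have h₁ := f.finrank_range_add_finrank_ker
  have h₂ := (LinearMap.range f).finrank_quotient_add_finrank
  omega

/-- The Calderon subspace has the dimension of the kernel it is the trace of. -/
theorem finrank_calderon (D : W →ₗ[𝕜] H) (γ : W →ₗ[𝕜] B)
    (hγ : Set.InjOn γ (LinearMap.ker D)) :
    Module.finrank 𝕜 ↥(Calderon D γ) = Module.finrank 𝕜 ↥(LinearMap.ker D) := by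
  have hinj : Function.Injective (γ.domRestrict (LinearMap.ker D)) :=
    Set.injOn_iff_injective.mp hγ
  rw [Calderon, ← LinearMap.range_domRestrict]
  exact LinearMap.finrank_range_of_inj hinj

/-- In finite dimensions, with `γ` surjective, the index of the boundary value
problem equals the index of `S(P)`:
`dim ker(D_P) − dim(H / D(dom(D_P))) = dim ker(S(P)) − dim(range(P) / P(K))`. -/
theorem statement12 [FiniteDimensional 𝕜 W] [FiniteDimensional 𝕜 H]
    [FiniteDimensional 𝕜 B]
    (D : W →ₗ[𝕜] H) (γ : W →ₗ[𝕜] B) (P : B →ₗ[𝕜] B)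
    (hDsurj : Function.Surjective D)
    (hγinj : Set.InjOn γ (LinearMap.ker D))
    (hPidem : P.comp P = P)
    (hγsurj : Function.Surjective γ) :
    (Module.finrank 𝕜 ↥(LinearMap.ker (bvp D γ P)) : ℤ) -
        Module.finrank 𝕜 (H ⧸ LinearMap.range (bvp D γ P)) =
      (Module.finrank 𝕜 ↥(LinearMap.ker (SP D γ P)) : ℤ) -
        Module.finrank 𝕜
          (↥(LinearMap.range P) ⧸ LinearMap.range (SP D γ P)) := by
  rw [finrank_ker_sub_finrank_coker, finrank_ker_sub_finrank_coker, finrank_calderon D γ hγinj]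
  have hD := D.finrank_range_add_finrank_ker
  rw [LinearMap.range_eq_top.mpr hDsurj, finrank_top] at hD
  have hP := (P.comp γ).finrank_range_add_finrank_ker
  rw [LinearMap.range_comp_of_range_eq_top P (LinearMap.range_eq_top.mpr hγsurj)] at hP
  rw [bvpDom]
  omega

end RelZeta
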